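/- arXiv:1502.03363 — 5 statements merged into one kernel-verified Lean document; each statement's English description precedes it below -/
import Mathlib

section
/- Fix an even integer N ≥ 2, a real number m > 1, an integer l ≥ 1, and a real number λ > 0. Let the sequences (a_j) and (b_j), 0 ≤ j ≤ N/2, be defined by a_0 = b_0 = 0 and, for j ≥ 1, a_j = (d_{N−2j+2} + a_{j−1} l²λ²)/(d_{N−2j+1} d_{N−2j+2} + a_{j−1} d_{N−2j+1} l²λ² + l²λ²) and b_j = (d_{2j−1} + b_{j−1} l²λ²)/(d_{2j} d_{2j−1} + b_{j−1} d_{2j} l²λ² + l²λ²). Then for every j with 0 ≤ j ≤ N/2 one has 0 ≤ a_j ≤ 2^{2m}/(lλ) and 0 ≤ b_j ≤ 1/(lλ). -/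
/-- `d_j = l^(2m) + (j-1)^(2m)` (1-based index `j ≥ 1`, natural subtraction,
real powers). -/
noncomputable def dseq (m : ℝ) (l : ℕ) (j : ℕ) : ℝ :=
  (l : ℝ) ^ (2 * m) + ((j - 1 : ℕ) : ℝ) ^ (2 * m)

/-- The recursive sequence `a_j`:  `a_0 = 0` and
`a_j = (d_{N-2j+2} + a_{j-1} l²λ²) /
       (d_{N-2j+1} d_{N-2j+2} + a_{j-1} d_{N-2j+1} l²λ² + l²λ²)`. -/
noncomputable def aseq (m : ℝ) (l : ℕ) (N : ℕ) (lam : ℝ) : ℕ → ℝ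
  | 0 => 0
  | j + 1 =>
      (dseq m l (N - 2 * (j + 1) + 2) + aseq m l N lam j * ((l : ℝ) * lam) ^ 2) /
        (dseq m l (N - 2 * (j + 1) + 1) * dseq m l (N - 2 * (j + 1) + 2)
          + aseq m l N lam j * dseq m l (N - 2 * (j + 1) + 1) * ((l : ℝ) * lam) ^ 2
          + ((l : ℝ) * lam) ^ 2)

/-- The recursive sequence `b_j`:  `b_0 = 0` and
`b_j = (d_{2j-1} + b_{j-1} l²λ²) /
       (d_{2j} d_{2j-1} + b_{j-1} d_{2j} l²λ² + l²λ²)`. -/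
noncomputable def bseq (m : ℝ) (l : ℕ) (lam : ℝ) : ℕ → ℝ
  | 0 => 0
  | j + 1 =>
      (dseq m l (2 * (j + 1) - 1) + bseq m l lam j * ((l : ℝ) * lam) ^ 2) /
        (dseq m l (2 * (j + 1)) * dseq m l (2 * (j + 1) - 1)
          + bseq m l lam j * dseq m l (2 * (j + 1)) * ((l : ℝ) * lam) ^ 2
          + ((l : ℝ) * lam) ^ 2)

theorem dseq_pos {m : ℝ} {l : ℕ} (hl : 1 ≤ l) (j : ℕ) : 0 < dseq m l j := by
  have hl' : (0 : ℝ) < l := by exact_mod_cast hl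
  unfold dseq
  positivity

theorem dseq_mono {m : ℝ} (hm : 0 ≤ m) (l : ℕ) : Monotone (dseq m l) := by
  intro i j hij
  have hsub : ((i - 1 : ℕ) : ℝ) ≤ ((j - 1 : ℕ) : ℝ) := by
    exact_mod_cast Nat.sub_le_sub_right hij 1
  unfold dseq
  gcongr

theorem dseq_add_two_le {m : ℝ} (hm : 1 ≤ 2 * m) {l : ℕ} (hl : 1 ≤ l) (k : ℕ) :
    dseq m l (k + 2) ≤ (2 : ℝ) ^ (2 * m) * dseq m l (k + 1) := by
  have hm0 : 0 ≤ 2 * m := by linarith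
  have hl' : (1 : ℝ) ≤ l := by exact_mod_cast hl
  have hL : (1 : ℝ) ≤ (l : ℝ) ^ (2 * m) := Real.one_le_rpow hl' hm0
  have htwo : (2 : ℝ) ≤ (2 : ℝ) ^ (2 * m) :=
    Real.self_le_rpow_of_one_le one_le_two hm
  simp only [dseq, Nat.add_sub_cancel, show k + 2 - 1 = k + 1 by omega]
  rcases Nat.eq_zero_or_pos k with rfl | hk
  · have hzero : ((0 : ℕ) : ℝ) ^ (2 * m) = 0 := by
      rw [Nat.cast_zero, Real.zero_rpow (by linarith)]
    rw [hzero]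
    norm_num
    nlinarith
  · have hk' : (1 : ℝ) ≤ k := by exact_mod_cast hk
    have hdouble : ((k + 1 : ℕ) : ℝ) ^ (2 * m) ≤ (2 : ℝ) ^ (2 * m) * (k : ℝ) ^ (2 * m) := by
      rw [← Real.mul_rpow zero_le_two k.cast_nonneg]
      refine Real.rpow_le_rpow (by positivity) ?_ hm0
      push_cast
      linarith
    nlinarith

/-- The interval `[0, C / s]` is invariant under the recursion step
`x ↦ (D + x s²) / (E D + x E s² + s²)` when `D ≤ C E` and `1 ≤ C`. -/
theorem recursion_step_bounds {C D E s x : ℝ} (hC : 1 ≤ C) (hD : 0 < D) (hE : 0 < E)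
    (hs : 0 < s) (hDE : D ≤ C * E) (hx : 0 ≤ x) (hxC : x ≤ C / s) :
    0 ≤ (D + x * s ^ 2) / (E * D + x * E * s ^ 2 + s ^ 2) ∧
      (D + x * s ^ 2) / (E * D + x * E * s ^ 2 + s ^ 2) ≤ C / s := by
  refine ⟨by positivity, ?_⟩
  rw [div_le_div_iff₀ (by positivity) hs]
  have hxs : x * s ≤ C := (le_div_iff₀ hs).mp hxC
  have hy : D + x * s ^ 2 ≤ C * (E + s) := by nlinarith
  have hy0 : 0 ≤ D + x * s ^ 2 := by positivity
  have key : (s - C * E) * (D + x * s ^ 2) ≤ C * s ^ 2 := by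
    rcases le_total s (C * E) with h | h
    · exact (mul_nonpos_of_nonpos_of_nonneg (by linarith) hy0).trans (by positivity)
    · calc (s - C * E) * (D + x * s ^ 2) ≤ (s - C * E) * (C * (E + s)) :=
            mul_le_mul_of_nonneg_left hy (by linarith)
        _ = C * (s ^ 2 - (C - 1) * (E * s) - C * E ^ 2) := by ring
        _ ≤ C * s ^ 2 := by
            have h₁ : 0 ≤ (C - 1) * (E * s) := mul_nonneg (by linarith) (by positivity)
            have h₂ : 0 ≤ C * E ^ 2 := by positivity
            exact mul_le_mul_of_nonneg_left (by linarith) (by linarith)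
  linarith

theorem aseq_bounds {m : ℝ} (hm : 1 ≤ 2 * m) {l : ℕ} (hl : 1 ≤ l) (N : ℕ) {lam : ℝ}
    (hlam : 0 < lam) (j : ℕ) :
    0 ≤ aseq m l N lam j ∧ aseq m l N lam j ≤ (2 : ℝ) ^ (2 * m) / ((l : ℝ) * lam) := by
  have hs : 0 < (l : ℝ) * lam := mul_pos (by exact_mod_cast hl) hlam
  induction j with
  | zero =>
    rw [aseq]
    exact ⟨le_rfl, by positivity⟩
  | succ j ih =>
    rw [aseq]
    exact recursion_step_bounds (Real.one_le_rpow one_le_two (by linarith)) (dseq_pos hl _)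
      (dseq_pos hl _) hs (dseq_add_two_le hm hl _) ih.1 ih.2

theorem bseq_bounds {m : ℝ} (hm : 0 ≤ m) {l : ℕ} (hl : 1 ≤ l) {lam : ℝ}
    (hlam : 0 < lam) (j : ℕ) :
    0 ≤ bseq m l lam j ∧ bseq m l lam j ≤ 1 / ((l : ℝ) * lam) := by
  have hs : 0 < (l : ℝ) * lam := mul_pos (by exact_mod_cast hl) hlam
  induction j with
  | zero =>
    rw [bseq]
    exact ⟨le_rfl, by positivity⟩
  | succ j ih =>
    rw [bseq]
    refine recursion_step_bounds le_rfl (dseq_pos hl _) (dseq_pos hl _) hs ?_ ih.1 ih.2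
    rw [one_mul]
    exact dseq_mono hm l (Nat.sub_le _ _)

/-- for every `0 ≤ j ≤ N/2` one has `0 ≤ a_j ≤ 2^(2m)/(lλ)` and
`0 ≤ b_j ≤ 1/(lλ)`. -/
theorem aseq_bseq_bounds (N : ℕ) (hN : 2 ≤ N) (hNeven : Even N)
    (m : ℝ) (hm : 1 < m) (l : ℕ) (hl : 1 ≤ l) (lam : ℝ) (hlam : 0 < lam)
    (j : ℕ) (hj : j ≤ N / 2) :
    (0 ≤ aseq m l N lam j ∧ aseq m l N lam j ≤ (2 : ℝ) ^ (2 * m) / ((l : ℝ) * lam)) ∧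
    (0 ≤ bseq m l lam j ∧ bseq m l lam j ≤ 1 / ((l : ℝ) * lam)) := by
  exact ⟨aseq_bounds (by linarith) hl N hlam j, bseq_bounds (by linarith) hl hlam j⟩
end

section
/- Fix an even integer N ≥ 2, a real number m > 1, an integer l with 1 ≤ l ≤ N, and a real number λ > 0. Then the entries of the 2×2 diagonal blocks of (T^l_λ)^{−1} satisfy, for every j = 0, …, N/2 − 1: |((T^l_λ)^{−1})_{2j+1,2j+1}| ≤ 2^{2m}/(lλ), |((T^l_λ)^{−1})_{2j+1,2j+2}| ≤ 1/(lλ), |((T^l_λ)^{−1})_{2j+2,2j+1}| ≤ 1/(lλ), and |((T^l_λ)^{−1})_{2j+2,2j+2}| ≤ 1/(lλ). -/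
/-- The `N × N` tridiagonal matrix `T^l_λ` with diagonal entries
`d_j = l^(2m) + (j-1)^(2m)` (so, in the 0-based indexing of `Fin N`,
the entry at `(j, j)` is `l^(2m) + j^(2m)`), superdiagonal entries `-lλ`
and subdiagonal entries `lλ`.  Here `x ^ (2*m)` is the real power. -/
noncomputable def Tmat (N : ℕ) (m : ℝ) (l : ℕ) (lam : ℝ) :
    Matrix (Fin N) (Fin N) ℝ :=
  Matrix.of fun j k =>
    if (j : ℕ) = (k : ℕ) then (l : ℝ) ^ (2 * m) + (j : ℕ) ^ (2 * m)
    else if (j : ℕ) + 1 = (k : ℕ) then -((l : ℝ) * lam)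
    else if (k : ℕ) + 1 = (j : ℕ) then (l : ℝ) * lam
    else 0

/-- The vector `x` shifted by one and extended by zero: `0, x 0, …, x (N - 1), 0, 0, …`. -/
def zeroPad {N : ℕ} (x : Fin N → ℝ) : ℕ → ℝ
  | 0 => 0
  | i + 1 => if h : i < N then x ⟨i, h⟩ else 0

/-- The `i`-th diagonal entry of `Tmat`. -/
noncomputable def diagEntry (m : ℝ) (l i : ℕ) : ℝ := (l : ℝ) ^ (2 * m) + (i : ℝ) ^ (2 * m)

lemma Tmat_mulVec_apply {N : ℕ} (m : ℝ) (l : ℕ) (lam : ℝ) (x : Fin N → ℝ) (i : ℕ) (hi : i < N) :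
    (Tmat N m l lam).mulVec x ⟨i, hi⟩ =
      l * lam * zeroPad x i + diagEntry m l i * zeroPad x (i + 1)
        - l * lam * zeroPad x (i + 2) := by
  have key : (Tmat N m l lam).mulVec x ⟨i, hi⟩ = ∑ k ∈ Finset.range N,
      ((if k + 1 = i then l * lam * zeroPad x (k + 1) else 0)
        + (if i = k then diagEntry m l i * zeroPad x (k + 1) else 0)
        - (if i + 1 = k then l * lam * zeroPad x (k + 1) else 0)) := by
    rw [← Fin.sum_univ_eq_sum_range (fun k : ℕ =>
      ((if k + 1 = i then l * lam * zeroPad x (k + 1) else 0)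
        + (if i = k then diagEntry m l i * zeroPad x (k + 1) else 0)
        - (if i + 1 = k then l * lam * zeroPad x (k + 1) else 0))) N]
    simp only [Matrix.mulVec, dotProduct]
    refine Finset.sum_congr rfl fun k _ => ?_
    have hk : zeroPad x ((k : ℕ) + 1) = x k := by simp [zeroPad]
    rw [hk]
    simp only [Tmat, Matrix.of_apply, diagEntry]
    split_ifs <;> first | omega | ring
  rw [key, Finset.sum_sub_distrib, Finset.sum_add_distrib, Finset.sum_ite_eq, Finset.sum_ite_eq]
  have h1 : ∑ k ∈ Finset.range N, (if k + 1 = i then l * lam * zeroPad x (k + 1) else 0)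
      = l * lam * zeroPad x i := by
    cases i with
    | zero => simp [zeroPad]
    | succ n =>
      simp only [Nat.add_right_cancel_iff, Finset.sum_ite_eq', Finset.mem_range]
      rw [if_pos (by omega)]
  have h2 : (if i + 1 ∈ Finset.range N then (l : ℝ) * lam * zeroPad x (i + 1 + 1) else 0)
      = l * lam * zeroPad x (i + 2) := by
    split_ifs with h
    · rfl
    · simp only [Finset.mem_range] at h
      simp [zeroPad, h]
  rw [h1, h2, if_pos (Finset.mem_range.2 hi)]

lemma mul_le_of_le_add_mul {L c d₀ d₁ v : ℝ} (hL : 0 < L) (hc : 1 ≤ c) (h₀ : 0 < d₀)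
    (h₁ : 0 < d₁) (hd : d₁ ≤ c ^ 2 * d₀) (hv : 0 < v) (hvle : v ≤ d₁ + c * L) :
    L * v ≤ c * (d₀ * v + L ^ 2) := by
  have hc0 : 0 < c := by linarith
  rcases le_total L (c * d₀) with h | h
  · nlinarith [mul_le_mul_of_nonneg_right h hv.le, mul_pos hc0 (pow_pos hL 2)]
  · nlinarith [mul_le_mul_of_nonneg_right hvle (sub_nonneg.2 h), mul_pos hc0 (mul_pos h₀ h₁),
      mul_le_mul_of_nonneg_right hd hL.le]

section Recurrence

variable {d e y : ℕ → ℝ} {L c : ℝ} {N : ℕ}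

/-- Eliminating an even number of homogeneous rows from the top. -/
lemma exists_top_elimination (hL : 0 < L) (hd : ∀ i, 0 < d i) (hmono : Monotone d)
    (hy0 : y 0 = 0) (j : ℕ)
    (hrow : ∀ i < 2 * j, L * y i + d i * y (i + 1) - L * y (i + 2) = 0) :
    ∃ p, 0 ≤ p ∧ p ≤ L ∧ L * y (2 * j) = p * y (2 * j + 1) := by
  induction j with
  | zero => exact ⟨0, le_rfl, hL.le, by simp [hy0]⟩
  | succ j ih =>
    obtain ⟨p, hp0, hpL, hp⟩ := ih fun i hi => hrow i (by omega)
    have r₀ := hrow (2 * j) (by omega)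
    have r₁ := hrow (2 * j + 1) (by omega)
    have hd₀ := hd (2 * j)
    have hd₁ := hd (2 * j + 1)
    have hu : 0 < d (2 * j) + p := by linarith
    have hD : 0 < d (2 * j + 1) * (d (2 * j) + p) + L ^ 2 := by positivity
    refine ⟨L ^ 2 * (d (2 * j) + p) / (d (2 * j + 1) * (d (2 * j) + p) + L ^ 2),
      by positivity, ?_, ?_⟩
    · rw [div_le_iff₀ hD]
      have := mul_le_of_le_add_mul hL le_rfl hd₁ hd₀
        (by simpa using hmono (Nat.le_succ (2 * j))) hu (by linarith)
      nlinarith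
    · rw [div_mul_eq_mul_div, eq_div_iff hD.ne']
      rw [show 2 * (j + 1) = 2 * j + 2 by ring]
      simp only [add_assoc, Nat.reduceAdd] at *
      linear_combination (L * (d (2 * j) + p)) * r₁ - L ^ 2 * r₀ + L ^ 2 * hp

/-- Eliminating an even number of homogeneous rows from the bottom. -/
lemma exists_bottom_elimination (hL : 0 < L) (hc : 1 ≤ c) (hd : ∀ i, 0 < d i)
    (hratio : ∀ i, d (i + 1) ≤ c ^ 2 * d i) (hyN : y (N + 1) = 0) (t b : ℕ)
    (hb : b + 2 * t = N)
    (hrow : ∀ i, b ≤ i → i < N → L * y i + d i * y (i + 1) - L * y (i + 2) = 0) :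
    ∃ q, 0 ≤ q ∧ q ≤ c * L ∧ -(L * y (b + 1)) = q * y b := by
  induction t generalizing b with
  | zero =>
    obtain rfl : b = N := by omega
    exact ⟨0, le_rfl, by positivity, by simp [hyN]⟩
  | succ t ih =>
    obtain ⟨q, hq0, hqL, hq⟩ := ih (b + 2) (by omega) fun i hi hiN => hrow i (by omega) hiN
    have r₀ := hrow b le_rfl (by omega)
    have r₁ := hrow (b + 1) (by omega) (by omega)
    have hd₀ := hd b
    have hd₁ := hd (b + 1)
    have hv : 0 < d (b + 1) + q := by linarith
    have hD : 0 < d b * (d (b + 1) + q) + L ^ 2 := by positivity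
    refine ⟨L ^ 2 * (d (b + 1) + q) / (d b * (d (b + 1) + q) + L ^ 2), by positivity, ?_, ?_⟩
    · rw [div_le_iff₀ hD]
      have := mul_le_of_le_add_mul hL hc hd₀ hd₁ (hratio b) hv (by linarith)
      nlinarith
    · rw [div_mul_eq_mul_div, eq_div_iff hD.ne']
      simp only [add_assoc, Nat.reduceAdd] at *
      linear_combination (-L * (d (b + 1) + q)) * r₀ - L ^ 2 * r₁ + L ^ 2 * hq

/-- Reduction of a tridiagonal system, homogeneous outside the rows `2 * j` and `2 * j + 1`,
to a `2 × 2` system. -/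
lemma exists_block_solution (hL : 0 < L) (hc : 1 ≤ c) (hd : ∀ i, 0 < d i) (hmono : Monotone d)
    (hratio : ∀ i, d (i + 1) ≤ c ^ 2 * d i) (hN : Even N) (hy0 : y 0 = 0) (hyN : y (N + 1) = 0)
    {j : ℕ} (hj : j < N / 2)
    (hrow : ∀ i < N, L * y i + d i * y (i + 1) - L * y (i + 2) = e i)
    (he : ∀ i, i ≠ 2 * j → i ≠ 2 * j + 1 → e i = 0) :
    ∃ A B, 0 < A ∧ 0 < B ∧ L * A ≤ A * B + L ^ 2 ∧ L * B ≤ c * (A * B + L ^ 2) ∧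
      y (2 * j + 1) = (B * e (2 * j) + L * e (2 * j + 1)) / (A * B + L ^ 2) ∧
      y (2 * j + 2) = (A * e (2 * j + 1) - L * e (2 * j)) / (A * B + L ^ 2) := by
  obtain ⟨M, rfl⟩ := hN
  obtain ⟨p, hp0, hpL, hp⟩ := exists_top_elimination (y := y) hL hd hmono hy0 j fun i hi => by
    rw [hrow i (by omega), he i (by omega) (by omega)]
  obtain ⟨q, hq0, hqL, hq⟩ := exists_bottom_elimination (y := y) hL hc hd hratio hyN
    (M - j - 1) (2 * j + 2) (by omega) fun i hi hiN => by
      rw [hrow i hiN, he i (by omega) (by omega)]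
  have r₀ := hrow (2 * j) (by omega)
  have r₁ := hrow (2 * j + 1) (by omega)
  have hd₀ := hd (2 * j)
  have hd₁ := hd (2 * j + 1)
  have hA : 0 < d (2 * j) + p := by linarith
  have hB : 0 < d (2 * j + 1) + q := by linarith
  have hD : 0 < (d (2 * j) + p) * (d (2 * j + 1) + q) + L ^ 2 := by positivity
  refine ⟨d (2 * j) + p, d (2 * j + 1) + q, hA, hB, ?_, ?_, ?_, ?_⟩
  · have := mul_le_of_le_add_mul hL le_rfl hd₁ hd₀
      (by simpa using hmono (Nat.le_succ (2 * j))) hA (by linarith)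
    nlinarith [mul_nonneg hA.le hq0]
  · have := mul_le_of_le_add_mul hL hc hd₀ hd₁ (hratio (2 * j)) hB (by linarith)
    nlinarith [mul_nonneg (mul_nonneg hp0 hB.le) (zero_le_one.trans hc)]
  · rw [eq_div_iff hD.ne']
    simp only [add_assoc, Nat.reduceAdd] at *
    linear_combination (d (2 * j + 1) + q) * r₀ + L * r₁ - (d (2 * j + 1) + q) * hp - L * hq
  · rw [eq_div_iff hD.ne']
    simp only [add_assoc, Nat.reduceAdd] at *
    linear_combination (d (2 * j) + p) * r₁ - L * r₀ + L * hp - (d (2 * j) + p) * hq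

end Recurrence

lemma diagEntry_pos {m : ℝ} {l : ℕ} (hl : 1 ≤ l) (i : ℕ) : 0 < diagEntry m l i := by
  have : (0 : ℝ) < l := by exact_mod_cast hl
  unfold diagEntry
  positivity

lemma diagEntry_monotone {m : ℝ} (hm : 0 ≤ m) (l : ℕ) : Monotone (diagEntry m l) := by
  intro i k hik
  unfold diagEntry
  gcongr

lemma diagEntry_succ_le {m : ℝ} (hm : 1 < m) {l : ℕ} (hl : 1 ≤ l) (i : ℕ) :
    diagEntry m l (i + 1) ≤ ((2 : ℝ) ^ m) ^ 2 * diagEntry m l i := by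
  have hK : ((2 : ℝ) ^ m) ^ 2 = 2 ^ (2 * m) := by
    rw [← Real.rpow_natCast, ← Real.rpow_mul (by norm_num), mul_comm]
    norm_num
  have hl' : (1 : ℝ) ≤ (l : ℝ) ^ (2 * m) :=
    Real.one_le_rpow (by exact_mod_cast hl) (by linarith)
  have hK2 : (2 : ℝ) ≤ 2 ^ (2 * m) := by
    simpa using Real.rpow_le_rpow_of_exponent_le (one_le_two) (by linarith : 1 ≤ 2 * m)
  rw [hK]
  unfold diagEntry
  rcases Nat.eq_zero_or_pos i with rfl | hi
  · rw [Nat.cast_zero, Real.zero_rpow (by linarith)]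
    simp only [zero_add, Nat.cast_one, Real.one_rpow]
    nlinarith
  · have h : ((i + 1 : ℕ) : ℝ) ^ (2 * m) ≤ 2 ^ (2 * m) * (i : ℝ) ^ (2 * m) := by
      rw [← Real.mul_rpow (by norm_num) (by positivity)]
      refine Real.rpow_le_rpow (by positivity) ?_ (by linarith)
      have : (1 : ℝ) ≤ i := by exact_mod_cast hi
      push_cast
      linarith
    nlinarith

lemma zeroPad_succ_of_lt {N : ℕ} (x : Fin N → ℝ) {i : ℕ} (hi : i < N) :
    zeroPad x (i + 1) = x ⟨i, hi⟩ := by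
  simp [zeroPad, hi]

lemma exists_Tmat_block_solution {N : ℕ} (hN : Even N) {m : ℝ} (hm : 1 < m) {l : ℕ} (hl : 1 ≤ l)
    {lam : ℝ} (hlam : 0 < lam) {j : ℕ} (hj₀ : 2 * j < N)
    (hj₁ : 2 * j + 1 < N) (x : Fin N → ℝ) (e : ℕ → ℝ)
    (hx : ∀ i : Fin N, (Tmat N m l lam).mulVec x i = e i)
    (he : ∀ i, i ≠ 2 * j → i ≠ 2 * j + 1 → e i = 0) :
    ∃ A B, 0 < A ∧ 0 < B ∧ l * lam * A ≤ A * B + (l * lam) ^ 2 ∧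
      l * lam * B ≤ 2 ^ m * (A * B + (l * lam) ^ 2) ∧
      x ⟨2 * j, hj₀⟩ =
        (B * e (2 * j) + l * lam * e (2 * j + 1)) / (A * B + (l * lam) ^ 2) ∧
      x ⟨2 * j + 1, hj₁⟩ =
        (A * e (2 * j + 1) - l * lam * e (2 * j)) / (A * B + (l * lam) ^ 2) := by
  have hL : 0 < (l : ℝ) * lam := mul_pos (by exact_mod_cast hl) hlam
  rw [← zeroPad_succ_of_lt x, ← zeroPad_succ_of_lt x]
  exact exists_block_solution hL (Real.one_le_rpow one_le_two (by linarith)) (diagEntry_pos hl)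
    (diagEntry_monotone (by linarith) l) (diagEntry_succ_le hm hl) hN rfl (by simp [zeroPad])
    (by omega) (fun i hi => by rw [← Tmat_mulVec_apply m l lam x i hi]; exact hx ⟨i, hi⟩) he

lemma isUnit_Tmat {N : ℕ} (hN : Even N) {m : ℝ} (hm : 1 < m) {l : ℕ} (hl : 1 ≤ l)
    {lam : ℝ} (hlam : 0 < lam) : IsUnit (Tmat N m l lam) := by
  rw [← Matrix.mulVec_injective_iff_isUnit]
  refine (injective_iff_map_eq_zero (Tmat N m l lam).mulVecLin).2 fun x hx => ?_
  ext ⟨i, hi⟩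
  obtain ⟨M, rfl⟩ := hN
  obtain ⟨_, _, -, -, -, -, h₀, h₁⟩ := exists_Tmat_block_solution ⟨M, rfl⟩ hm hl hlam
    (j := i / 2) (by omega) (by omega) x (fun _ => 0) (fun k => congrFun hx k) (fun _ _ _ => rfl)
  rcases Nat.mod_two_eq_zero_or_one i with h | h
  · have : (⟨i, hi⟩ : Fin (M + M)) = ⟨2 * (i / 2), by omega⟩ := by ext; simp; omega
    rw [this, h₀]
    simp
  · have : (⟨i, hi⟩ : Fin (M + M)) = ⟨2 * (i / 2) + 1, by omega⟩ := by ext; simp; omega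
    rw [this, h₁]
    simp

lemma Tmat_mulVec_inv_col {N : ℕ} (hN : Even N) {m : ℝ} (hm : 1 < m) {l : ℕ} (hl : 1 ≤ l)
    {lam : ℝ} (hlam : 0 < lam) {k : ℕ} (hk : k < N) (i : Fin N) :
    (Tmat N m l lam).mulVec (fun r => (Tmat N m l lam)⁻¹ r ⟨k, hk⟩) i =
      if (i : ℕ) = k then 1 else 0 := by
  have h := congrFun (congrFun (Matrix.mul_nonsing_inv (Tmat N m l lam)
    ((Matrix.isUnit_iff_isUnit_det _).1 (isUnit_Tmat hN hm hl hlam))) i) ⟨k, hk⟩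
  rw [Matrix.mul_apply, Matrix.one_apply] at h
  simp only [Matrix.mulVec, dotProduct, h, Fin.ext_iff]

/-- bounds on the entries of the `2 × 2` diagonal blocks of
`(T^l_λ)⁻¹`.  In the 1-based indexing of the paper the block `j`
(`j = 0, …, N/2 - 1`) occupies rows and columns `2j+1, 2j+2`, i.e. the rows
and columns of 0-based indices `2j, 2j+1`. -/
theorem Tmat_inv_diag_block_bounds (N : ℕ) (hN : 2 ≤ N) (hNeven : Even N)
    (m : ℝ) (hm : 1 < m) (l : ℕ) (hl1 : 1 ≤ l) (hlN : l ≤ N)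
    (lam : ℝ) (hlam : 0 < lam) (j : ℕ) (hj : j < N / 2) :
    |(Tmat N m l lam)⁻¹ ⟨2 * j, by omega⟩ ⟨2 * j, by omega⟩|
        ≤ (2 : ℝ) ^ (2 * m) / ((l : ℝ) * lam) ∧
    |(Tmat N m l lam)⁻¹ ⟨2 * j, by omega⟩ ⟨2 * j + 1, by omega⟩|
        ≤ 1 / ((l : ℝ) * lam) ∧
    |(Tmat N m l lam)⁻¹ ⟨2 * j + 1, by omega⟩ ⟨2 * j, by omega⟩|
        ≤ 1 / ((l : ℝ) * lam) ∧
    |(Tmat N m l lam)⁻¹ ⟨2 * j + 1, by omega⟩ ⟨2 * j + 1, by omega⟩|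
        ≤ 1 / ((l : ℝ) * lam) := by
  have hL : 0 < (l : ℝ) * lam := mul_pos (by exact_mod_cast hl1) hlam
  have h2m : (2 : ℝ) ^ m ≤ 2 ^ (2 * m) :=
    Real.rpow_le_rpow_of_exponent_le one_le_two (by linarith)
  have hj₀ : 2 * j < N := by omega
  have hj₁ : 2 * j + 1 < N := by omega
  have col₀ := Tmat_mulVec_inv_col hNeven hm hl1 hlam hj₀
  have col₁ := Tmat_mulVec_inv_col hNeven hm hl1 hlam hj₁
  obtain ⟨A, B, hA, hB, -, hBle, h₀₀, h₁₀⟩ :=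
    exists_Tmat_block_solution hNeven hm hl1 hlam hj₀ hj₁
    (fun r => (Tmat N m l lam)⁻¹ r ⟨2 * j, hj₀⟩) (fun i => if i = 2 * j then 1 else 0)
    col₀ (fun i h _ => if_neg h)
  obtain ⟨A', B', hA', hB', hAle, -, h₀₁, h₁₁⟩ :=
    exists_Tmat_block_solution hNeven hm hl1 hlam hj₀ hj₁
      (fun r => (Tmat N m l lam)⁻¹ r ⟨2 * j + 1, hj₁⟩)
      (fun i => if i = 2 * j + 1 then 1 else 0)
      col₁ (fun i _ h => if_neg h)
  have hD : 0 < A * B + (l * lam) ^ 2 := by positivity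
  have hD' : 0 < A' * B' + (l * lam) ^ 2 := by positivity
  simp only [if_true, Nat.succ_ne_self, (Nat.succ_ne_self _).symm, if_false, mul_one, mul_zero,
    add_zero, zero_add, sub_zero, zero_sub] at h₀₀ h₁₀ h₀₁ h₁₁
  rw [h₀₀, h₁₀, h₀₁, h₁₁, neg_div, abs_neg, abs_of_pos (div_pos hB hD),
    abs_of_pos (div_pos hL hD'), abs_of_pos (div_pos hL hD), abs_of_pos (div_pos hA' hD')]
  refine ⟨?_, ?_, ?_, ?_⟩
  · rw [div_le_div_iff₀ hD hL]
    linarith [mul_le_mul_of_nonneg_right h2m hD.le]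
  · rw [div_le_div_iff₀ hD' hL]
    linarith [mul_pos hA' hB']
  · rw [div_le_div_iff₀ hD hL]
    linarith [mul_pos hA hB]
  · rw [div_le_div_iff₀ hD' hL]
    linarith
end

section
/- For every finitely supported a : ℤ² → ℂ², the quadratic nonlinearity Nonl commutes with the symmetry S′, i.e. Nonl(S′a) = S′(Nonl(a)). -/
/-- The symmetry `S′` on families `a : ℤ² → ℂ²` of Fourier coefficients:
if `k¹` and `k²` are both even or both odd (equivalently `k¹ + k²` is even)
then `(S′a)¹_k = -a¹_{(-k¹,k²)}` and `(S′a)²_k = a²_{(-k¹,k²)}`; otherwise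
`(S′a)¹_k = a¹_{(-k¹,k²)}` and `(S′a)²_k = -a²_{(-k¹,k²)}`. -/
noncomputable def Ssym (a : ℤ × ℤ → ℂ × ℂ) : ℤ × ℤ → ℂ × ℂ := fun k =>
  if Even (k.1 + k.2) then
    (-(a (-k.1, k.2)).1, (a (-k.1, k.2)).2)
  else
    ((a (-k.1, k.2)).1, -(a (-k.1, k.2)).2)

/-- The quadratic nonlinearity `Nonl`:
`Nonl(a)^j_k = Σ_{k₁+k₂=k} a¹_{k₁} k₂¹ a^j_{k₂} + Σ_{k₁+k₂=k} a²_{k₁} k₂² a^j_{k₂}`,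
written with `k₂ = k - k₁` and finite sums (`∑ᶠ`) over `k₁ : ℤ²`. -/
noncomputable def Nonl (a : ℤ × ℤ → ℂ × ℂ) : ℤ × ℤ → ℂ × ℂ := fun k =>
  ((∑ᶠ k₁ : ℤ × ℤ, (a k₁).1 * ((k - k₁).1 : ℂ) * (a (k - k₁)).1)
      + ∑ᶠ k₁ : ℤ × ℤ, (a k₁).2 * ((k - k₁).2 : ℂ) * (a (k - k₁)).1,
   (∑ᶠ k₁ : ℤ × ℤ, (a k₁).1 * ((k - k₁).1 : ℂ) * (a (k - k₁)).2)
      + ∑ᶠ k₁ : ℤ × ℤ, (a k₁).2 * ((k - k₁).2 : ℂ) * (a (k - k₁)).2)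

/-- The reflection `(k¹, k²) ↦ (-k¹, k²)` of `ℤ²`. -/
def reflectFst : ℤ × ℤ ≃ ℤ × ℤ := (Equiv.neg ℤ).prodCongr (Equiv.refl ℤ)

theorem finsum_eq_mul_finsum_of_reflectFst {f g : ℤ × ℤ → ℂ} (c : ℂ)
    (h : ∀ m n, f (-m, n) = c * g (m, n)) : ∑ᶠ k, f k = c * ∑ᶠ k, g k := by
  rw [← finsum_comp_equiv reflectFst, ← smul_eq_mul, smul_finsum]
  exact finsum_congr fun k => h k.1 k.2

theorem Ssym_apply (a : ℤ × ℤ → ℂ × ℂ) (m n : ℤ) :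
    Ssym a (m, n) = (-(-1) ^ (m + n) * (a (-m, n)).1, (-1) ^ (m + n) * (a (-m, n)).2) := by
  by_cases h : Even (m + n)
  · simp [Ssym, h, h.neg_one_zpow]
  · simp [Ssym, h, (Int.not_even_iff_odd.mp h).neg_one_zpow]

theorem neg_one_zpow_reflect_mul (m n x y : ℤ) :
    (-1 : ℂ) ^ (-x + y) * (-1) ^ (m - -x + (n - y)) = (-1) ^ (m + n) := by
  rw [← zpow_add₀ (by norm_num)]
  congr 1
  ring

/-- for every finitely supported `a : ℤ² → ℂ²`, the nonlinearity
`Nonl` commutes with the symmetry `S′`: `Nonl(S′a) = S′(Nonl a)`. -/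
theorem Nonl_comm_Ssym (a : ℤ × ℤ → ℂ × ℂ)
    (ha : (Function.support a).Finite) :
    Nonl (Ssym a) = Ssym (Nonl a) := by
  funext ⟨m, n⟩
  rw [Ssym_apply]
  simp only [Nonl, mul_add]
  congr 2 <;> refine finsum_eq_mul_finsum_of_reflectFst _ fun x y => ?_
  all_goals
    rw [← neg_one_zpow_reflect_mul m n x y]
    simp only [Prod.mk_sub_mk, Ssym_apply, neg_neg, show -(m - -x) = -m - x by ring]
    push_cast
    ring
end

section
/- Fix an integer N ≥ 4, a real number m > 1, an integer l with 1 ≤ l ≤ N, and a real number λ. Set b₁ = d_1/(d_1 d_2 + l²λ²). Then the lower-right (N−2)×(N−2) submatrix of T(d_1,…,d_N)^{−1} equals T(d_3 + l²λ² b₁, d_4,…,d_N)^{−1}; that is, for all p, q ∈ {1,…,N−2}, (T(d_1,…,d_N)^{−1})_{p+2,q+2} = (T(d_3 + l²λ² b₁, d_4,…,d_N)^{−1})_{p,q}. -/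
/-- The `M × M` tridiagonal matrix with diagonal entries `c 0, …, c (M-1)`,
superdiagonal entries `-μ` and subdiagonal entries `μ` (in the application,
`μ = lλ`). -/
noncomputable def Tgen (M : ℕ) (c : Fin M → ℝ) (μ : ℝ) :
    Matrix (Fin M) (Fin M) ℝ :=
  Matrix.of fun j k =>
    if (j : ℕ) = (k : ℕ) then c j
    else if (j : ℕ) + 1 = (k : ℕ) then -μ
    else if (k : ℕ) + 1 = (j : ℕ) then μ
    else 0

/-- `d_j = l^(2m) + (j-1)^(2m)` written 0-based: `dd i = l^(2m) + i^(2m)`,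
so that `d_j = dd (j-1)` for the 1-based index `j`; real powers. -/
noncomputable def dd (m : ℝ) (l : ℕ) (i : ℕ) : ℝ :=
  (l : ℝ) ^ (2 * m) + (i : ℝ) ^ (2 * m)

open Matrix in
/-- A generalized tridiagonal matrix with positive diagonal is invertible, because its symmetric
part is the positive definite diagonal matrix with the same diagonal. -/
theorem isUnit_det_Tgen {M : ℕ} {c : Fin M → ℝ} (hc : ∀ i, 0 < c i) (μ : ℝ) :
    IsUnit (Tgen M c μ).det := by
  rw [isUnit_iff_ne_zero]
  intro h
  obtain ⟨v, hv, hTv⟩ := Matrix.exists_mulVec_eq_zero_iff.mpr h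
  have hsymm : Tgen M c μ + (Tgen M c μ)ᵀ = (2 : ℝ) • diagonal c := by
    ext i j
    rcases eq_or_ne i j with rfl | hij
    · simp [Tgen, two_mul]
    · have hij' : (i : ℕ) ≠ j := Fin.val_ne_of_ne hij
      simp only [Tgen, Matrix.add_apply, of_apply, transpose_apply, Matrix.smul_apply,
        diagonal_apply_ne _ hij, if_neg hij', if_neg hij'.symm, smul_zero]
      split_ifs <;> first | omega | simp
  have hquad : v ⬝ᵥ ((2 : ℝ) • diagonal c) *ᵥ v = 0 := by
    rw [← hsymm, add_mulVec, dotProduct_add, mulVec_transpose, dotProduct_comm v (v ᵥ* _),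
      ← dotProduct_mulVec, hTv]
    simp
  have hsum : ∑ i, c i * v i ^ 2 = 0 := by
    rw [smul_mulVec, dotProduct_smul, smul_eq_mul] at hquad
    rw [← (mul_eq_zero.mp hquad).resolve_left two_ne_zero]
    simp only [dotProduct, mulVec_diagonal]
    exact Finset.sum_congr rfl fun i _ => by ring
  rw [Finset.sum_eq_zero_iff_of_nonneg fun i _ => mul_nonneg (hc i).le (sq_nonneg _)] at hsum
  refine hv (funext fun i => ?_)
  simpa [(hc i).ne'] using hsum i (Finset.mem_univ i)

/-- Eliminating the first row and column: deleting them from the inverse of a generalized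
tridiagonal matrix gives the inverse of the matrix with one diagonal entry corrected. -/
theorem Tgen_inv_succ_succ {n : ℕ} {c : Fin (n + 2) → ℝ} (hc : ∀ i, 0 < c i) (μ : ℝ)
    (p q : Fin (n + 1)) :
    (Tgen (n + 2) c μ)⁻¹ p.succ q.succ =
      (Tgen (n + 1) (fun i => if (i : ℕ) = 0 then c 1 + μ ^ 2 / c 0 else c i.succ) μ)⁻¹ p q := by
  have hmul := Matrix.mul_nonsing_inv _ (isUnit_det_Tgen hc μ)
  set X := (Tgen (n + 2) c μ)⁻¹
  suffices h : Tgen (n + 1) (fun i => if (i : ℕ) = 0 then c 1 + μ ^ 2 / c 0 else c i.succ) μ *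
      X.submatrix Fin.succ Fin.succ = 1 by
    rw [Matrix.inv_eq_right_inv h, Matrix.submatrix_apply]
  ext i j
  have hfirst : c 0 * X 0 j.succ = μ * X 1 j.succ := by
    have h := congrFun (congrFun hmul 0) j.succ
    rw [Matrix.mul_apply, Fin.sum_univ_succ, Fin.sum_univ_succ] at h
    simp [Tgen, (Fin.succ_ne_zero j).symm] at h
    linarith
  have hrow := congrFun (congrFun hmul i.succ) j.succ
  rw [Matrix.mul_apply, Fin.sum_univ_succ, Fin.sum_univ_succ] at hrow
  rw [Matrix.mul_apply, Fin.sum_univ_succ]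
  have hc0 := (hc 0).ne'
  have hone : (1 : Matrix (Fin (n + 2)) (Fin (n + 2)) ℝ) i.succ j.succ =
      (1 : Matrix (Fin (n + 1)) (Fin (n + 1)) ℝ) i j := by
    simp [Matrix.one_apply]
  rw [← hone, ← hrow]
  have hX0 : X 0 j.succ = μ * X 1 j.succ / c 0 := by
    rw [← hfirst]; field_simp
  rw [hX0]
  refine Fin.cases ?_ (fun k => ?_) i
  · simp [Tgen]
    field_simp
    ring
  · simp [Tgen]

theorem dd_pos (m : ℝ) {l : ℕ} (hl : 1 ≤ l) (i : ℕ) : 0 < dd m l i :=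
  add_pos_of_pos_of_nonneg (Real.rpow_pos_of_pos (by exact_mod_cast hl) _)
    (Real.rpow_nonneg (Nat.cast_nonneg _) _)

/-- with `b₁ = d_1 / (d_1 d_2 + l²λ²)`, the lower-right
`(N-2) × (N-2)` submatrix of `T(d_1, …, d_N)⁻¹` equals
`T(d_3 + l²λ² b₁, d_4, …, d_N)⁻¹` entrywise. -/
theorem Tmat_inv_lower_right_block (N : ℕ) (hN : 4 ≤ N) (m : ℝ) (hm : 1 < m)
    (l : ℕ) (hl1 : 1 ≤ l) (hlN : l ≤ N) (lam : ℝ) :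
    ∀ p q : Fin (N - 2),
      (Tgen N (fun i => dd m l i) ((l : ℝ) * lam))⁻¹
          ⟨(p : ℕ) + 2, by have := p.isLt; omega⟩
          ⟨(q : ℕ) + 2, by have := q.isLt; omega⟩
        = (Tgen (N - 2)
            (fun i =>
              if (i : ℕ) = 0 then
                dd m l 2 + ((l : ℝ) * lam) ^ 2 *
                  (dd m l 0 / (dd m l 0 * dd m l 1 + ((l : ℝ) * lam) ^ 2))
              else dd m l ((i : ℕ) + 2))
            ((l : ℝ) * lam))⁻¹ p q := by
  obtain ⟨n, rfl⟩ : ∃ n, N = n + 3 := ⟨N - 3, by omega⟩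
  intro p q
  set μ := (l : ℝ) * lam
  have hd := dd_pos m hl1
  have hc : ∀ i : Fin (n + 2),
      0 < if (i : ℕ) = 0 then dd m l 1 + μ ^ 2 / dd m l 0 else dd m l (i + 1) := by
    intro i
    have h0 := hd 0
    have h1 := hd 1
    split_ifs
    · positivity
    · exact hd _
  have hcorr : μ ^ 2 / (dd m l 1 + μ ^ 2 / dd m l 0) =
      μ ^ 2 * (dd m l 0 / (dd m l 0 * dd m l 1 + μ ^ 2)) := by
    have h0 := hd 0
    have h1 := hd 1
    field_simp
  have hfst := Tgen_inv_succ_succ (c := fun i : Fin (n + 3) => dd m l i) (fun i => hd i) μ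
    (Fin.succ p) (Fin.succ q)
  have hsnd := Tgen_inv_succ_succ hc μ p q
  simp only [Fin.val_zero, Fin.val_one, Fin.val_succ, if_true, one_ne_zero, if_false,
    Nat.add_one_ne_zero, hcorr] at hfst hsnd
  exact hfst.trans hsnd
end

section
/- Fix an integer N ≥ 2, a real number m > 1, an integer l with 1 ≤ l ≤ N, and a real number λ > 1. Suppose n is an integer with 1 ≤ n < N and n^{2m} > 2^{2m+1} lλ. Then the tail of the first column of (T^l_λ)^{−1} satisfies Σ_{i=n+1}^{N} |((T^l_λ)^{−1})_{i,1}| ≤ 2·|((T^l_λ)^{−1})_{n,1}| ≤ 2^{2m+1}/(lλ). -/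
/-- Extension of a finite vector by zero to a sequence. -/
def finExtend {N : ℕ} (v : Fin N → ℝ) (j : ℕ) : ℝ :=
  if h : j < N then v ⟨j, h⟩ else 0

lemma finExtend_val {N : ℕ} (v : Fin N → ℝ) (i : Fin N) : finExtend v i = v i := by
  simp [finExtend]

lemma finExtend_of_le {N : ℕ} (v : Fin N → ℝ) {j : ℕ} (h : N ≤ j) : finExtend v j = 0 := by
  simp [finExtend, h.not_gt]

lemma Tmat_mulVec_eq_sum_range {N : ℕ} (m : ℝ) (l : ℕ) (lam : ℝ) (v : Fin N → ℝ) (j : Fin N) :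
    (Tmat N m l lam).mulVec v j = ∑ k ∈ Finset.range N,
      ((if k = (j : ℕ) then ((l : ℝ) ^ (2 * m) + (j : ℕ) ^ (2 * m)) * finExtend v k else 0)
        + (if k = (j : ℕ) + 1 then -((l : ℝ) * lam) * finExtend v k else 0)
        + (if k + 1 = (j : ℕ) then (l : ℝ) * lam * finExtend v k else 0)) := by
  rw [Finset.sum_range, Matrix.mulVec, dotProduct]
  refine Finset.sum_congr rfl fun k _ => ?_
  rw [finExtend_val]
  simp only [Tmat, Matrix.of_apply]
  split_ifs <;> first | omega | ring

lemma sum_range_ite_finExtend {N : ℕ} (v : Fin N → ℝ) (c : ℝ) (i : ℕ) :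
    ∑ k ∈ Finset.range N, (if k = i then c * finExtend v k else 0) = c * finExtend v i := by
  rw [Finset.sum_ite_eq']
  split_ifs with h
  · rfl
  · rw [finExtend_of_le v (by simpa using h), mul_zero]

lemma Tmat_mulVec_zero {N : ℕ} (m : ℝ) (l : ℕ) (lam : ℝ) (v : Fin N → ℝ) (h : 0 < N) :
    (Tmat N m l lam).mulVec v ⟨0, h⟩ =
      ((l : ℝ) ^ (2 * m) + ((0 : ℕ) : ℝ) ^ (2 * m)) * finExtend v 0
        - (l : ℝ) * lam * finExtend v 1 := by
  rw [Tmat_mulVec_eq_sum_range]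
  simp only [Finset.sum_add_distrib, sum_range_ite_finExtend, Nat.add_eq_zero_iff, one_ne_zero,
    and_false, if_false, Finset.sum_const_zero]
  ring

lemma Tmat_mulVec_succ {N : ℕ} (m : ℝ) (l : ℕ) (lam : ℝ) (v : Fin N → ℝ) (j : ℕ) (h : j + 1 < N) :
    (Tmat N m l lam).mulVec v ⟨j + 1, h⟩ = (l : ℝ) * lam * finExtend v j
      + ((l : ℝ) ^ (2 * m) + ((j + 1 : ℕ) : ℝ) ^ (2 * m)) * finExtend v (j + 1)
        - (l : ℝ) * lam * finExtend v (j + 2) := by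
  rw [Tmat_mulVec_eq_sum_range]
  simp only [Finset.sum_add_distrib, sum_range_ite_finExtend, Nat.add_right_cancel_iff]
  ring

section Recurrence

variable {N : ℕ} {a : ℝ} {d y : ℕ → ℝ}

lemma mul_succ_nonpos_of_recurrence (ha : 0 < a) (hd : ∀ j, 0 < d j) (hy : ∀ j, N ≤ j → y j = 0)
    (hrec : ∀ j, j + 1 < N → a * y j + d (j + 1) * y (j + 1) - a * y (j + 2) = 0) (j : ℕ) :
    y j * y (j + 1) ≤ 0 := by
  rcases le_total N j with hj | hj
  · simp [hy j hj]
  · induction hj using Nat.decreasingInduction with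
    | self => simp [hy N le_rfl]
    | of_succ j hj ih =>
      rcases Nat.lt_or_ge (j + 1) N with h | h
      · have h1 : a * (y j * y (j + 1)) + d (j + 1) * (y (j + 1) * y (j + 1))
            - a * (y (j + 1) * y (j + 2)) = 0 := by
          linear_combination y (j + 1) * hrec j h
        have h2 : 0 ≤ d (j + 1) * (y (j + 1) * y (j + 1)) :=
          mul_nonneg (hd _).le (mul_self_nonneg _)
        have h3 : a * (y (j + 1) * y (j + 2)) ≤ 0 := mul_nonpos_of_nonneg_of_nonpos ha.le ih
        exact nonpos_of_mul_nonpos_right (by linarith) ha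
      · simp [hy (j + 1) h]

lemma abs_mul_sub_mul_of_mul_nonpos {a c u v : ℝ} (ha : 0 ≤ a) (hc : 0 ≤ c) (h : u * v ≤ 0) :
    |c * u - a * v| = c * |u| + a * |v| := by
  rcases mul_nonpos_iff.1 h with ⟨hu, hv⟩ | ⟨hu, hv⟩
  · rw [abs_of_nonneg hu, abs_of_nonpos hv, abs_of_nonneg]
    · ring
    · linarith [mul_nonneg hc hu, mul_nonpos_of_nonneg_of_nonpos ha hv]
  · rw [abs_of_nonpos hu, abs_of_nonneg hv, abs_of_nonpos]
    · ring
    · linarith [mul_nonneg ha hv, mul_nonpos_of_nonneg_of_nonpos hc hu]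

lemma abs_recurrence (ha : 0 < a) (hd : ∀ j, 0 < d j) (hy : ∀ j, N ≤ j → y j = 0)
    (hrec : ∀ j, j + 1 < N → a * y j + d (j + 1) * y (j + 1) - a * y (j + 2) = 0)
    (j : ℕ) (hj : j + 1 < N) :
    d (j + 1) * |y (j + 1)| + a * |y (j + 2)| = a * |y j| := by
  rw [← abs_mul_sub_mul_of_mul_nonpos ha.le (hd _).le
    (mul_succ_nonpos_of_recurrence ha hd hy hrec (j + 1)), ← abs_of_pos ha, ← abs_mul,
    abs_of_pos ha, ← abs_neg (a * y j)]
  congr 1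
  linear_combination hrec j hj

lemma mul_abs_succ_le (ha : 0 < a) (hd : ∀ j, 0 < d j) (hy : ∀ j, N ≤ j → y j = 0)
    (hrec : ∀ j, j + 1 < N → a * y j + d (j + 1) * y (j + 1) - a * y (j + 2) = 0) (j : ℕ) :
    d (j + 1) * |y (j + 1)| ≤ a * |y j| := by
  rcases Nat.lt_or_ge (j + 1) N with h | h
  · have := abs_recurrence ha hd hy hrec j h
    have := mul_nonneg ha.le (abs_nonneg (y (j + 2)))
    linarith
  · rw [hy _ h, abs_zero, mul_zero]
    positivity

lemma abs_add_two_le (ha : 0 < a) (hd : ∀ j, 0 < d j) (hy : ∀ j, N ≤ j → y j = 0)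
    (hrec : ∀ j, j + 1 < N → a * y j + d (j + 1) * y (j + 1) - a * y (j + 2) = 0) (j : ℕ) :
    |y (j + 2)| ≤ |y j| := by
  rcases Nat.lt_or_ge (j + 1) N with h | h
  · have := abs_recurrence ha hd hy hrec j h
    have := mul_nonneg (hd (j + 1)).le (abs_nonneg (y (j + 1)))
    exact le_of_mul_le_mul_left (by linarith) ha
  · rw [hy _ (by omega), abs_zero]
    positivity

lemma mul_abs_odd_le (ha : 0 < a) (hd : ∀ j, 0 < d j) (hy : ∀ j, N ≤ j → y j = 0)
    (hrec : ∀ j, j + 1 < N → a * y j + d (j + 1) * y (j + 1) - a * y (j + 2) = 0)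
    (h0 : d 0 * y 0 - a * y 1 = 1) (k : ℕ) : a * |y (2 * k + 1)| ≤ 1 := by
  induction k with
  | zero =>
    have h := abs_mul_sub_mul_of_mul_nonpos ha.le (hd 0).le
      (mul_succ_nonpos_of_recurrence ha hd hy hrec 0)
    rw [zero_add, h0, abs_one] at h
    have := mul_nonneg (hd 0).le (abs_nonneg (y 0))
    simp only [mul_zero, zero_add]
    linarith
  | succ k ih =>
    exact (mul_le_mul_of_nonneg_left (abs_add_two_le ha hd hy hrec (2 * k + 1)) ha.le).trans ih

lemma mul_abs_le_one (ha : 0 < a) (hd : ∀ j, 0 < d j) (hy : ∀ j, N ≤ j → y j = 0)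
    (hrec : ∀ j, j + 1 < N → a * y j + d (j + 1) * y (j + 1) - a * y (j + 2) = 0)
    (h0 : d 0 * y 0 - a * y 1 = 1) {p : ℕ} (hp : 1 ≤ p) (hap : a ≤ d p) : a * |y p| ≤ 1 := by
  rcases Nat.even_or_odd' p with ⟨k, rfl | rfl⟩
  · obtain ⟨i, rfl⟩ : ∃ i, k = i + 1 := ⟨k - 1, by omega⟩
    exact (mul_le_mul_of_nonneg_right hap (abs_nonneg _)).trans
      ((mul_abs_succ_le ha hd hy hrec (2 * i + 1)).trans (mul_abs_odd_le ha hd hy hrec h0 i))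
  · exact mul_abs_odd_le ha hd hy hrec h0 k

lemma eq_zero_of_recurrence (ha : 0 < a) (hd : ∀ j, 0 < d j) (hy : ∀ j, N ≤ j → y j = 0)
    (hrec : ∀ j, j + 1 < N → a * y j + d (j + 1) * y (j + 1) - a * y (j + 2) = 0)
    (h0 : d 0 * y 0 - a * y 1 = 0) (j : ℕ) : y j = 0 := by
  induction j with
  | zero =>
    have h := abs_mul_sub_mul_of_mul_nonpos ha.le (hd 0).le
      (mul_succ_nonpos_of_recurrence ha hd hy hrec 0)
    rw [zero_add, h0, abs_zero] at h
    have := mul_nonneg ha.le (abs_nonneg (y 1))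
    exact abs_nonpos_iff.1 (nonpos_of_mul_nonpos_right (by linarith) (hd 0))
  | succ j ih =>
    have h := mul_abs_succ_le ha hd hy hrec j
    rw [ih, abs_zero, mul_zero] at h
    exact abs_nonpos_iff.1 (nonpos_of_mul_nonpos_right h (hd _))

end Recurrence

lemma sum_tail_le_of_halving {z : ℕ → ℝ} (hz : ∀ j, 0 ≤ z j) {p : ℕ}
    (hhalf : ∀ j, p ≤ j → 2 * z (j + 1) ≤ z j) (k : ℕ) (hk : p ≤ k) :
    ∑ i ∈ Finset.range (k + 1), (if p + 1 ≤ i then z i else 0) ≤ z p := by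
  suffices h : ∑ i ∈ Finset.range (k + 1), (if p + 1 ≤ i then z i else 0) + z k ≤ z p by
    linarith [hz k]
  induction k, hk using Nat.le_induction with
  | base =>
    rw [Finset.sum_eq_zero, zero_add]
    intro i hi
    rw [if_neg (by have := Finset.mem_range.1 hi; omega)]
  | succ k hk ih =>
    rw [Finset.sum_range_succ, if_pos (by omega)]
    linarith [hhalf k hk]

lemma Tmat_det_ne_zero {N : ℕ} (m : ℝ) {l : ℕ} (hl : 1 ≤ l) {lam : ℝ} (hlam : 0 < lam) :
    (Tmat N m l lam).det ≠ 0 := by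
  have hl0 : (0 : ℝ) < l := by exact_mod_cast hl
  intro hdet
  obtain ⟨v, hv, hTv⟩ := Matrix.exists_mulVec_eq_zero_iff.2 hdet
  refine hv (funext fun i => ?_)
  have hN : 0 < N := i.pos
  rw [← finExtend_val v i]
  refine eq_zero_of_recurrence (N := N) (a := l * lam)
    (d := fun j => (l : ℝ) ^ (2 * m) + (j : ℝ) ^ (2 * m)) (mul_pos hl0 hlam)
    (fun j => by positivity) (fun j => finExtend_of_le v) (fun j hj => ?_) ?_ i
  · rw [← Tmat_mulVec_succ m l lam v j hj, hTv, Pi.zero_apply]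
  · rw [← Tmat_mulVec_zero m l lam v hN, hTv, Pi.zero_apply]

/-- if `1 ≤ n < N` and `n^(2m) > 2^(2m+1) lλ`, then the tail of
the first column of `(T^l_λ)⁻¹` satisfies
`Σ_{i=n+1}^N |((T^l_λ)⁻¹)_{i,1}| ≤ 2 |((T^l_λ)⁻¹)_{n,1}| ≤ 2^(2m+1)/(lλ)`.
In the 0-based indexing of `Fin N`, the 1-based entry `(i, 1)` is `(i-1, 0)`,
so the tail sum ranges over rows of 0-based index `≥ n`. -/
theorem Tmat_inv_first_column_tail (N : ℕ) (hN : 2 ≤ N)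
    (m : ℝ) (hm : 1 < m) (l : ℕ) (hl1 : 1 ≤ l) (hlN : l ≤ N)
    (lam : ℝ) (hlam : 1 < lam) (n : ℕ) (hn1 : 1 ≤ n) (hnN : n < N)
    (hbig : (2 : ℝ) ^ (2 * m + 1) * ((l : ℝ) * lam) < (n : ℝ) ^ (2 * m)) :
    (∑ i : Fin N,
        if n ≤ (i : ℕ) then |(Tmat N m l lam)⁻¹ i ⟨0, by omega⟩| else 0)
      ≤ 2 * |(Tmat N m l lam)⁻¹ ⟨n - 1, by omega⟩ ⟨0, by omega⟩| ∧
    2 * |(Tmat N m l lam)⁻¹ ⟨n - 1, by omega⟩ ⟨0, by omega⟩|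
      ≤ (2 : ℝ) ^ (2 * m + 1) / ((l : ℝ) * lam) := by
  have hl0 : (0 : ℝ) < l := by exact_mod_cast hl1
  have hl1' : (1 : ℝ) ≤ l := by exact_mod_cast hl1
  have hN0 : 0 < N := by omega
  have ha1 : 1 < (l : ℝ) * lam := by nlinarith
  set v : Fin N → ℝ := fun i => (Tmat N m l lam)⁻¹ i ⟨0, hN0⟩ with hv
  have hTv (i : Fin N) : (Tmat N m l lam).mulVec v i = if i = ⟨0, hN0⟩ then 1 else 0 := by
    have h := congrFun (congrFun (Matrix.mul_nonsing_inv (Tmat N m l lam)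
      (isUnit_iff_ne_zero.2 (Tmat_det_ne_zero m hl1 (by linarith)))) i) ⟨0, hN0⟩
    rw [Matrix.one_apply] at h
    exact h
  obtain ⟨p, rfl⟩ : ∃ p, n = p + 1 := ⟨n - 1, by omega⟩
  have hpow : (2 : ℝ) ^ (2 * m + 1) = 2 * 2 ^ (2 * m) := by
    rw [Real.rpow_add_one (by norm_num)]; ring
  have h2m : (1 : ℝ) ≤ 2 ^ (2 * m) := Real.one_le_rpow (by norm_num) (by linarith)
  rw [hpow] at hbig
  have hp1 : 1 ≤ p := by
    by_contra! hp
    obtain rfl : p = 0 := by omega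
    norm_num at hbig
    nlinarith
  set y : ℕ → ℝ := finExtend v with hy
  set a : ℝ := l * lam with ha
  set d : ℕ → ℝ := fun j => (l : ℝ) ^ (2 * m) + (j : ℝ) ^ (2 * m) with hd
  have ha0 : 0 < a := by linarith
  have hd0 (j : ℕ) : 0 < d j := by positivity
  have hy0 (j : ℕ) (hj : N ≤ j) : y j = 0 := finExtend_of_le v hj
  have hrec (j : ℕ) (hj : j + 1 < N) :
      a * y j + d (j + 1) * y (j + 1) - a * y (j + 2) = 0 := by
    rw [← Tmat_mulVec_succ m l lam v j hj, hTv, if_neg (by simp)]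
  have hrec0 : d 0 * y 0 - a * y 1 = 1 := by
    rw [← Tmat_mulVec_zero m l lam v hN0, hTv, if_pos rfl]
  have hdp (j : ℕ) (hj : p ≤ j) : 2 * a ≤ d j := by
    have h1 : ((p + 1 : ℕ) : ℝ) ≤ 2 * j := by exact_mod_cast (by omega : p + 1 ≤ 2 * j)
    have h2 : ((p + 1 : ℕ) : ℝ) ^ (2 * m) ≤ 2 ^ (2 * m) * (j : ℝ) ^ (2 * m) := by
      rw [← Real.mul_rpow (by norm_num) (by positivity)]
      exact Real.rpow_le_rpow (by positivity) h1 (by linarith)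
    have h3 : 2 * a ≤ (j : ℝ) ^ (2 * m) :=
      le_of_mul_le_mul_left (by linarith : 2 ^ (2 * m) * (2 * a) ≤ 2 ^ (2 * m) * (j : ℝ) ^ (2 * m))
        (by linarith)
    have h4 : (0 : ℝ) ≤ (l : ℝ) ^ (2 * m) := by positivity
    simp only [hd]
    linarith
  have hyp : (Tmat N m l lam)⁻¹ ⟨p + 1 - 1, by omega⟩ ⟨0, hN0⟩ = y p :=
    (finExtend_val v ⟨p, by omega⟩).symm
  rw [hyp]
  constructor
  · have hsum : (∑ i : Fin N, if p + 1 ≤ (i : ℕ) then |(Tmat N m l lam)⁻¹ i ⟨0, hN0⟩| else 0)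
        = ∑ i ∈ Finset.range (N - 1 + 1), if p + 1 ≤ i then |y i| else 0 := by
      rw [Nat.sub_add_cancel hN0, Finset.sum_range]
      refine Finset.sum_congr rfl fun i _ => ?_
      rw [hy, finExtend_val]
    rw [hsum]
    refine (sum_tail_le_of_halving (fun j => abs_nonneg (y j)) (fun j hj => ?_) (N - 1)
      (by omega)).trans (by linarith [abs_nonneg (y p)])
    have h1 := mul_abs_succ_le ha0 hd0 hy0 hrec j
    have h2 := mul_le_mul_of_nonneg_right (hdp (j + 1) (by omega)) (abs_nonneg (y (j + 1)))
    exact le_of_mul_le_mul_left (by linarith) ha0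
  · have h := mul_abs_le_one ha0 hd0 hy0 hrec hrec0 hp1 (by linarith [hdp p le_rfl])
    rw [le_div_iff₀ ha0, hpow]
    linarith
end
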